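/- Let n be a positive integer, f an integer with 0 ≤ f < n, and κ > 0. If an aggregation rule F : (ℝ^d)^n → ℝ^d is (f,κ)-robust, then F is (f,λ)-resilient averaging with λ = √(κ/2); that is, for all x_1, …, x_n ∈ ℝ^d and every S ⊆ {1,…,n} with |S| = n − f, it holds that ‖F(x_1,…,x_n) − x̄_S‖ ≤ √(κ/2) · max_{i,j ∈ S} ‖x_i − x_j‖, where x̄_S = (1/|S|) Σ_{i∈S} x_i. -/

import Mathlib

open scoped InnerProductSpace in
/-- The sum of squared pairwise distances of a finite family with zero sum. -/
theorem sum_sum_norm_sub_sq_of_sum_eq_zero {ι E : Type*} [NormedAddCommGroup E]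
    [InnerProductSpace ℝ E] (S : Finset ι) (y : ι → E) (hy : ∑ i ∈ S, y i = 0) :
    ∑ i ∈ S, ∑ j ∈ S, ‖y i - y j‖ ^ 2 = 2 * (S.card : ℝ) * ∑ i ∈ S, ‖y i‖ ^ 2 := by
  have hinner : ∀ i, ∑ j ∈ S, ⟪y i, y j⟫_ℝ = 0 := fun i => by
    rw [← inner_sum, hy, inner_zero_right]
  simp only [norm_sub_sq_real, Finset.sum_add_distrib, Finset.sum_sub_distrib, ← Finset.mul_sum,
    hinner, Finset.sum_const, nsmul_eq_mul]
  ring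

/-- The sum of squared pairwise distances is `2 |S|` times the sum of squared deviations from
the mean. -/
theorem sum_sum_norm_sub_sq_eq {ι E : Type*} [NormedAddCommGroup E] [InnerProductSpace ℝ E]
    (S : Finset ι) (hS : S.Nonempty) (x : ι → E) :
    ∑ i ∈ S, ∑ j ∈ S, ‖x i - x j‖ ^ 2 =
      2 * (S.card : ℝ) * ∑ i ∈ S, ‖x i - (S.card : ℝ)⁻¹ • ∑ j ∈ S, x j‖ ^ 2 := by
  have hm : (S.card : ℝ) ≠ 0 := Nat.cast_ne_zero.mpr hS.card_ne_zero
  rw [← sum_sum_norm_sub_sq_of_sum_eq_zero S fun i => x i - (S.card : ℝ)⁻¹ • ∑ j ∈ S, x j]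
  · simp only [sub_sub_sub_cancel_right]
  · rw [Finset.sum_sub_distrib, Finset.sum_const, ← Nat.cast_smul_eq_nsmul ℝ,
      smul_inv_smul₀ hm, sub_self]

/-- `(f,κ)`-robustness implies `(f,λ)`-resilient averaging with `λ = √(κ/2)`:
the error is bounded by `√(κ/2)` times the maximal pairwise distance within `S`. -/
theorem robust_implies_resilient (n d f : ℕ) (hn : 0 < n) (hf : f < n) (κ : ℝ) (hκ : 0 < κ)
    (F : (Fin n → EuclideanSpace ℝ (Fin d)) → EuclideanSpace ℝ (Fin d))
    (hrobust : ∀ (x : Fin n → EuclideanSpace ℝ (Fin d)) (S : Finset (Fin n)),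
      S.card = n - f →
      ‖F x - (S.card : ℝ)⁻¹ • ∑ i ∈ S, x i‖ ^ 2 ≤
        (κ / (S.card : ℝ)) * ∑ i ∈ S, ‖x i - (S.card : ℝ)⁻¹ • ∑ j ∈ S, x j‖ ^ 2) :
    ∀ (x : Fin n → EuclideanSpace ℝ (Fin d)) (S : Finset (Fin n)) (hS : S.card = n - f),
      ‖F x - (S.card : ℝ)⁻¹ • ∑ i ∈ S, x i‖ ≤
        Real.sqrt (κ / 2) *
          (S ×ˢ S).sup'
            (by
              have hne : S.Nonempty := Finset.card_pos.mp (by rw [hS]; omega)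
              exact hne.product hne)
            (fun p => ‖x p.1 - x p.2‖) := by
  intro x S hS
  have hne : S.Nonempty := Finset.card_pos.mp (by rw [hS]; omega)
  have hm : (0 : ℝ) < S.card := Nat.cast_pos.mpr hne.card_pos
  set M := (S ×ˢ S).sup' (hne.product hne) (fun p => ‖x p.1 - x p.2‖)
  have hle : ∀ i ∈ S, ∀ j ∈ S, ‖x i - x j‖ ≤ M := fun i hi j hj =>
    Finset.le_sup' (fun p : Fin n × Fin n => ‖x p.1 - x p.2‖) (Finset.mk_mem_product hi hj)
  have hM : 0 ≤ M := by
    obtain ⟨i, hi⟩ := hne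
    exact (norm_nonneg _).trans (hle i hi i hi)
  have hsum : ∑ i ∈ S, ∑ j ∈ S, ‖x i - x j‖ ^ 2 ≤ S.card * (S.card * M ^ 2) := by
    simp only [← nsmul_eq_mul]
    exact Finset.sum_le_card_nsmul _ _ _ fun i hi => Finset.sum_le_card_nsmul _ _ _ fun j hj =>
      pow_le_pow_left₀ (norm_nonneg _) (hle i hi j hj) 2
  rw [sum_sum_norm_sub_sq_eq S hne x] at hsum
  have hvar : ∑ i ∈ S, ‖x i - (S.card : ℝ)⁻¹ • ∑ j ∈ S, x j‖ ^ 2 ≤ S.card * M ^ 2 / 2 := by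
    refine le_of_mul_le_mul_left ?_ hm
    linarith
  refine pow_le_pow_iff_left₀ (norm_nonneg _) (by positivity) two_ne_zero |>.mp ?_
  calc _ ≤ _ := hrobust x S hS
    _ ≤ κ / S.card * (S.card * M ^ 2 / 2) := by gcongr
    _ = (Real.sqrt (κ / 2) * M) ^ 2 := by
      rw [mul_pow, Real.sq_sqrt (by positivity)]
      field_simp
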